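/- For every vector field X ∈ {L₁, …, L_n, L₁̄, …, L_n̄, T} and every multi-index J = (J₁, …, J_t) ∈ {1,…,n}^t there exist smooth functions c_K on Ω, indexed by multi-indices K ∈ {1,…,n}^{t′} with t′ ≤ t − 1, such that, as operators on smooth ℂ-valued functions on Ω, X ∘ L^J = L^J ∘ X + Σ_{|K| ≤ |J|−1} c_K · (L^K ∘ T), where L^J := L_{J₁} ∘ ⋯ ∘ L_{J_t} (composition of the vector fields as first-order operators) and c_K·(L^K∘T) denotes the operator u ↦ c_K·(L^K(Tu)). -/

import Mathlib

open scoped Topology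

noncomputable section

/-- A complex vector field on (an open subset of) `ℝ^m`, given by its components:
it acts on functions by `(Xu)(x) = Du(x)·X(x)`. -/
abbrev VF (m : ℕ) := (Fin m → ℝ) → Fin m → ℂ

/-- The action `(Xu)(x) = Du(x)·X(x)` of a complex vector field on a function. -/
noncomputable def vapp {m : ℕ} (X : VF m) (u : (Fin m → ℝ) → ℂ) (x : Fin m → ℝ) : ℂ :=
  ∑ i, X x i * fderiv ℝ u x (Pi.single i 1)

/-- The Lie bracket `[X,Y](x) = DY(x)·X(x) − DX(x)·Y(x)` of complex vector fields. -/
noncomputable def vbrk {m : ℕ} (X Y : VF m) : VF m :=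
  fun x j => vapp X (fun y => Y y j) x - vapp Y (fun y => X y j) x

/-- The componentwise complex conjugate `X̄` of a complex vector field. -/
def vconj {m : ℕ} (X : VF m) : VF m := fun x i => (starRingEnd ℂ) (X x i)

/-- A normalized frame (Lemma 1.33): `T, L_A, L_Ā` is a smooth pointwise basis of `ℂ^{2n+1}`
on `Ω` with `T` real, `[L_A, L_B] = 0`, `[L_Ā, L_B] = −h_{ĀB}·T`, `[L_Ā, T] = −h_Ā·T`, and
each `[L_A, T]` a smooth multiple of `T`.  The fields `lv` and `hb` are the Levi functions
`h_{ĀB}` and `h_Ā`. -/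
structure NFrame (n : ℕ) (Ω : Set (Fin (2 * n + 1) → ℝ)) (T : VF (2 * n + 1))
    (L : Fin n → VF (2 * n + 1))
    (lv : Fin n → Fin n → (Fin (2 * n + 1) → ℝ) → ℂ)
    (hb : Fin n → (Fin (2 * n + 1) → ℝ) → ℂ) : Prop where
  open_Ω : IsOpen Ω
  mem0 : (0 : Fin (2 * n + 1) → ℝ) ∈ Ω
  smoothT : ContDiffOn ℝ (⊤ : ℕ∞) T Ω
  smoothL : ∀ A, ContDiffOn ℝ (⊤ : ℕ∞) (L A) Ω
  smooth_lv : ∀ A B, ContDiffOn ℝ (⊤ : ℕ∞) (lv A B) Ω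
  smooth_hb : ∀ A, ContDiffOn ℝ (⊤ : ℕ∞) (hb A) Ω
  Treal : ∀ x i, (starRingEnd ℂ) (T x i) = T x i
  indep : ∀ x ∈ Ω, LinearIndependent ℂ
    (Sum.elim (fun _ : Fin 1 => T x) (Sum.elim (fun A => L A x) (fun A => vconj (L A) x)))
  spans : ∀ x ∈ Ω, Submodule.span ℂ
    (Set.range (Sum.elim (fun _ : Fin 1 => T x)
      (Sum.elim (fun A => L A x) (fun A => vconj (L A) x)))) = ⊤
  commLL : ∀ A B, ∀ x ∈ Ω, vbrk (L A) (L B) x = 0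
  commLbL : ∀ A B, ∀ x ∈ Ω, vbrk (vconj (L A)) (L B) x = fun i => -(lv A B x) * T x i
  commLbT : ∀ A, ∀ x ∈ Ω, vbrk (vconj (L A)) T x = fun i => -(hb A x) * T x i
  commLT : ∀ A, ∃ c : (Fin (2 * n + 1) → ℝ) → ℂ, ContDiffOn ℝ (⊤ : ℕ∞) c Ω ∧
    ∀ x ∈ Ω, vbrk (L A) T x = fun i => c x * T x i

/-- Auxiliary: the iterated Levi function `h_{Ā₁…Ā_k}` (`T`-component), with the index list
given in *reverse* order `[A_k,…,A₁]`, defined by the recursion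
`h_{Ās C̄} = L_C̄ h_{Ās} + h_{Ās}·h_C̄`. -/
noncomputable def hTrev {n : ℕ} (L : Fin n → VF (2 * n + 1))
    (hb : Fin n → (Fin (2 * n + 1) → ℝ) → ℂ) :
    List (Fin n) → (Fin (2 * n + 1) → ℝ) → ℂ
  | [] => fun _ => 1
  | [C] => hb C
  | C :: rest => fun x =>
      vapp (vconj (L C)) (hTrev L hb rest) x + hTrev L hb rest x * hb C x

/-- Auxiliary: the iterated Levi function `h_{Ā₁…Ā_k D}`, with the index list given in
*reverse* order `[A_k,…,A₁]`, defined by the recursion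
`h_{Ās C̄ D} = L_C̄ h_{Ās D} + h_{Ās}·h_{C̄D}`. -/
noncomputable def hDrev {n : ℕ} (L : Fin n → VF (2 * n + 1))
    (lv : Fin n → Fin n → (Fin (2 * n + 1) → ℝ) → ℂ)
    (hb : Fin n → (Fin (2 * n + 1) → ℝ) → ℂ) :
    List (Fin n) → Fin n → (Fin (2 * n + 1) → ℝ) → ℂ
  | [], _ => fun _ => 0
  | [C], D => lv C D
  | C :: rest, D => fun x =>
      vapp (vconj (L C)) (hDrev L lv hb rest D) x + hTrev L hb rest x * lv C D x

/-- The iterated Levi function `h_{Ā₁…Ā_k D}`, for `As = [A₁,…,A_k]`. -/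
noncomputable def hIt {n : ℕ} (L : Fin n → VF (2 * n + 1))
    (lv : Fin n → Fin n → (Fin (2 * n + 1) → ℝ) → ℂ)
    (hb : Fin n → (Fin (2 * n + 1) → ℝ) → ℂ)
    (As : List (Fin n)) (D : Fin n) : (Fin (2 * n + 1) → ℝ) → ℂ :=
  hDrev L lv hb As.reverse D

/-- The iterated Levi function `h_{Ā₁…Ā_k}`, for `As = [A₁,…,A_k]`. -/
noncomputable def hTIt {n : ℕ} (L : Fin n → VF (2 * n + 1))
    (hb : Fin n → (Fin (2 * n + 1) → ℝ) → ℂ)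
    (As : List (Fin n)) : (Fin (2 * n + 1) → ℝ) → ℂ :=
  hTrev L hb As.reverse

/-- The composition `L^J = L_{J₁} ∘ ⋯ ∘ L_{J_t}` applied to a function, for `J = [J₁,…,J_t]`. -/
noncomputable def appOp {n : ℕ} (L : Fin n → VF (2 * n + 1)) (J : List (Fin n))
    (u : (Fin (2 * n + 1) → ℝ) → ℂ) : (Fin (2 * n + 1) → ℝ) → ℂ :=
  J.foldr (fun j v => vapp (L j) v) u

lemma vapp_congr {m : ℕ} {Ω : Set (Fin m → ℝ)} (hΩ : IsOpen Ω) (X : VF m)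
    {u v : (Fin m → ℝ) → ℂ} (h : ∀ x ∈ Ω, u x = v x) : ∀ x ∈ Ω, vapp X u x = vapp X v x := by
  intro x hx
  have : u =ᶠ[𝓝 x] v := by
    filter_upwards [hΩ.mem_nhds hx] with y hy using h y hy
  unfold vapp
  rw [this.fderiv_eq]

lemma vapp_add' {m : ℕ} (X : VF m) {u v : (Fin m → ℝ) → ℂ} {x : Fin m → ℝ}
    (hu : DifferentiableAt ℝ u x) (hv : DifferentiableAt ℝ v x) :
    vapp X (fun y => u y + v y) x = vapp X u x + vapp X v x := by
  unfold vapp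
  rw [fderiv_fun_add hu hv, ← Finset.sum_add_distrib]
  refine Finset.sum_congr rfl fun i _ => ?_
  simp [mul_add]

lemma vapp_mul' {m : ℕ} (X : VF m) {u v : (Fin m → ℝ) → ℂ} {x : Fin m → ℝ}
    (hu : DifferentiableAt ℝ u x) (hv : DifferentiableAt ℝ v x) :
    vapp X (fun y => u y * v y) x = vapp X u x * v x + u x * vapp X v x := by
  unfold vapp
  rw [fderiv_fun_mul hu hv, Finset.sum_mul, Finset.mul_sum, ← Finset.sum_add_distrib]
  refine Finset.sum_congr rfl fun i _ => ?_
  simp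
  ring

lemma vapp_sum' {m : ℕ} {ι : Type*} (s : Finset ι) (X : VF m) {u : ι → (Fin m → ℝ) → ℂ}
    {x : Fin m → ℝ} (hu : ∀ i ∈ s, DifferentiableAt ℝ (u i) x) :
    vapp X (fun y => ∑ i ∈ s, u i y) x = ∑ i ∈ s, vapp X (u i) x := by
  unfold vapp
  rw [fderiv_fun_sum hu, Finset.sum_comm]
  refine Finset.sum_congr rfl fun i _ => ?_
  simp [Finset.mul_sum]

lemma smooth_partial {m : ℕ} {Ω : Set (Fin m → ℝ)} (hΩ : IsOpen Ω)
    {u : (Fin m → ℝ) → ℂ} (hu : ContDiffOn ℝ (⊤ : ℕ∞) u Ω) (v : Fin m → ℝ) :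
    ContDiffOn ℝ (⊤ : ℕ∞) (fun y => fderiv ℝ u y v) Ω := by
  have := hu.fderiv_of_isOpen (m := (⊤ : ℕ∞)) hΩ (by simp)
  exact this.clm_apply contDiffOn_const

lemma smooth_vapp {m : ℕ} {Ω : Set (Fin m → ℝ)} (hΩ : IsOpen Ω) {X : VF m}
    (hX : ContDiffOn ℝ (⊤ : ℕ∞) X Ω)
    {u : (Fin m → ℝ) → ℂ} (hu : ContDiffOn ℝ (⊤ : ℕ∞) u Ω) :
    ContDiffOn ℝ (⊤ : ℕ∞) (vapp X u) Ω := by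
  unfold vapp
  refine ContDiffOn.sum fun i _ => ?_
  exact ((contDiffOn_pi.1 hX) i).mul (smooth_partial hΩ hu _)

lemma smooth_diff {m : ℕ} {Ω : Set (Fin m → ℝ)} (hΩ : IsOpen Ω)
    {u : (Fin m → ℝ) → ℂ} (hu : ContDiffOn ℝ (⊤ : ℕ∞) u Ω) {x : Fin m → ℝ} (hx : x ∈ Ω) :
    DifferentiableAt ℝ u x :=
  (hu.contDiffAt (hΩ.mem_nhds hx)).differentiableAt (by simp)

lemma vapp_vapp {m : ℕ} {Ω : Set (Fin m → ℝ)} (hΩ : IsOpen Ω) (X : VF m) {Y : VF m}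
    (hY : ContDiffOn ℝ (⊤ : ℕ∞) Y Ω)
    {u : (Fin m → ℝ) → ℂ} (hu : ContDiffOn ℝ (⊤ : ℕ∞) u Ω) {x : Fin m → ℝ} (hx : x ∈ Ω) :
    vapp X (vapp Y u) x = ∑ i, vapp X (fun y => Y y i) x * fderiv ℝ u x (Pi.single i 1)
      + ∑ i, ∑ k, X x k * Y x i *
          fderiv ℝ (fderiv ℝ u) x (Pi.single k 1) (Pi.single i 1) := by
  have hd : DifferentiableAt ℝ (fderiv ℝ u) x :=
    ((hu.fderiv_of_isOpen (m := (⊤ : ℕ∞)) hΩ (by simp)).contDiffAt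
      (hΩ.mem_nhds hx)).differentiableAt (by simp)
  have h1 : ∀ i, DifferentiableAt ℝ (fun y => Y y i) x := fun i =>
    smooth_diff hΩ ((contDiffOn_pi.1 hY) i) hx
  have h2 : ∀ i : Fin m, DifferentiableAt ℝ (fun y => fderiv ℝ u y (Pi.single i 1)) x := fun i =>
    smooth_diff hΩ (smooth_partial hΩ hu _) hx
  change vapp X (fun y => ∑ i, Y y i * fderiv ℝ u y (Pi.single i 1)) x = _
  rw [vapp_sum' _ _ (fun i _ => (h1 i).fun_mul (h2 i)), ← Finset.sum_add_distrib]
  refine Finset.sum_congr rfl fun i _ => ?_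
  rw [vapp_mul' X (h1 i) (h2 i)]
  congr 1
  rw [vapp, Finset.mul_sum]
  refine Finset.sum_congr rfl fun k _ => ?_
  rw [fderiv_clm_apply hd (by fun_prop)]
  simp
  ring

lemma vapp_comm {m : ℕ} {Ω : Set (Fin m → ℝ)} (hΩ : IsOpen Ω) {X Y : VF m}
    (hX : ContDiffOn ℝ (⊤ : ℕ∞) X Ω) (hY : ContDiffOn ℝ (⊤ : ℕ∞) Y Ω)
    {u : (Fin m → ℝ) → ℂ} (hu : ContDiffOn ℝ (⊤ : ℕ∞) u Ω) {x : Fin m → ℝ} (hx : x ∈ Ω) :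
    vapp X (vapp Y u) x = vapp Y (vapp X u) x + vapp (vbrk X Y) u x := by
  rw [vapp_vapp hΩ X hY hu hx, vapp_vapp hΩ Y hX hu hx]
  have hs : IsSymmSndFDerivAt ℝ u x :=
    (hu.contDiffAt (hΩ.mem_nhds hx)).isSymmSndFDerivAt (by
      simp only [minSmoothness_of_isRCLikeNormedField]
      exact WithTop.coe_le_coe.2 (le_top (a := (2 : ℕ∞))))
  have e : ∑ i, ∑ k, X x k * Y x i *
          fderiv ℝ (fderiv ℝ u) x (Pi.single k 1) (Pi.single i 1)
      = ∑ i, ∑ k, Y x k * X x i *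
          fderiv ℝ (fderiv ℝ u) x (Pi.single k 1) (Pi.single i 1) := by
    rw [Finset.sum_comm]
    refine Finset.sum_congr rfl fun i _ => Finset.sum_congr rfl fun k _ => ?_
    rw [hs.eq]
    ring
  rw [e]
  have e2 : vapp (vbrk X Y) u x = ∑ i, vapp X (fun y => Y y i) x * fderiv ℝ u x (Pi.single i 1)
      - ∑ i, vapp Y (fun y => X y i) x * fderiv ℝ u x (Pi.single i 1) := by
    simp only [vapp, vbrk, sub_mul, Finset.sum_sub_distrib]
  rw [e2]
  ring

lemma appOp_cons {n : ℕ} (L : Fin n → VF (2 * n + 1)) (j : Fin n) (J : List (Fin n))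
    (u : (Fin (2 * n + 1) → ℝ) → ℂ) : appOp L (j :: J) u = vapp (L j) (appOp L J u) := rfl

lemma smooth_appOp {n : ℕ} {Ω : Set (Fin (2 * n + 1) → ℝ)} (hΩ : IsOpen Ω)
    {L : Fin n → VF (2 * n + 1)} (hL : ∀ A, ContDiffOn ℝ (⊤ : ℕ∞) (L A) Ω) (J : List (Fin n))
    {u : (Fin (2 * n + 1) → ℝ) → ℂ} (hu : ContDiffOn ℝ (⊤ : ℕ∞) u Ω) :
    ContDiffOn ℝ (⊤ : ℕ∞) (appOp L J u) Ω := by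
  induction J with
  | nil => exact hu
  | cons j J ih => exact smooth_vapp hΩ (hL j) ih

/-- Operators representable as combinations of `L^K ∘ T`, `|K| < k`. -/
def TRep {n : ℕ} (Ω : Set (Fin (2 * n + 1) → ℝ)) (T : VF (2 * n + 1))
    (L : Fin n → VF (2 * n + 1)) (k : ℕ)
    (F : ((Fin (2 * n + 1) → ℝ) → ℂ) → (Fin (2 * n + 1) → ℝ) → ℂ) : Prop :=
  ∃ c : List (Fin n) → (Fin (2 * n + 1) → ℝ) → ℂ,
    (∀ K : List (Fin n), ContDiffOn ℝ (⊤ : ℕ∞) (c K) Ω) ∧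
    ∀ u : (Fin (2 * n + 1) → ℝ) → ℂ, ContDiffOn ℝ (⊤ : ℕ∞) u Ω → ∀ x ∈ Ω,
      F u x = ∑ t' ∈ Finset.range k, ∑ K : Fin t' → Fin n,
        c (List.ofFn K) x * appOp L (List.ofFn K) (vapp T u) x

section
variable {n : ℕ} {Ω : Set (Fin (2 * n + 1) → ℝ)} {T : VF (2 * n + 1)}
    {L : Fin n → VF (2 * n + 1)} {k : ℕ}
    {F G : ((Fin (2 * n + 1) → ℝ) → ℂ) → (Fin (2 * n + 1) → ℝ) → ℂ}

lemma TRep.congr (h : TRep Ω T L k F)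
    (e : ∀ u : (Fin (2 * n + 1) → ℝ) → ℂ, ContDiffOn ℝ (⊤ : ℕ∞) u Ω → ∀ x ∈ Ω, G u x = F u x) :
    TRep Ω T L k G := by
  obtain ⟨c, hc, h⟩ := h
  exact ⟨c, hc, fun u hu x hx => (e u hu x hx).trans (h u hu x hx)⟩

lemma TRep.zero : TRep Ω T L k (fun _ _ => 0) :=
  ⟨fun _ _ => 0, fun _ => contDiffOn_const, by simp⟩

lemma TRep.add (hF : TRep Ω T L k F) (hG : TRep Ω T L k G) :
    TRep Ω T L k (fun u x => F u x + G u x) := by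
  obtain ⟨c, hc, h⟩ := hF
  obtain ⟨d, hd, h'⟩ := hG
  refine ⟨fun K x => c K x + d K x, fun K => (hc K).add (hd K), fun u hu x hx => ?_⟩
  simp only [h u hu x hx, h' u hu x hx, add_mul, Finset.sum_add_distrib]

lemma TRep.sum {ι : Type*} (s : Finset ι)
    {F : ι → ((Fin (2 * n + 1) → ℝ) → ℂ) → (Fin (2 * n + 1) → ℝ) → ℂ}
    (h : ∀ i ∈ s, TRep Ω T L k (F i)) : TRep Ω T L k (fun u x => ∑ i ∈ s, F i u x) := by
  classical
  induction s using Finset.induction_on with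
  | empty => simpa using TRep.zero
  | insert a s ha ih =>
    simp only [Finset.sum_insert ha]
    exact (h a (Finset.mem_insert_self _ _)).add
      (ih fun i hi => h i (Finset.mem_insert_of_mem hi))

lemma TRep.single {a : (Fin (2 * n + 1) → ℝ) → ℂ} (ha : ContDiffOn ℝ (⊤ : ℕ∞) a Ω)
    (J : List (Fin n)) (hJ : J.length < k) :
    TRep Ω T L k (fun u x => a x * appOp L J (vapp T u) x) := by
  classical
  refine ⟨fun K => if K = J then a else fun _ => 0, fun K => ?_, fun u hu x hx => ?_⟩
  · dsimp only
    split_ifs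
    exacts [ha, contDiffOn_const]
  · symm
    rw [Finset.sum_eq_single J.length, Finset.sum_eq_single J.get]
    · simp [List.ofFn_get]
    · intro K _ hK
      beta_reduce
      rw [if_neg]
      · simp
      · intro h
        apply hK
        apply List.ofFn_injective
        rw [h, List.ofFn_get]
    · simp
    · intro t _ ht
      refine Finset.sum_eq_zero fun K _ => ?_
      beta_reduce
      rw [if_neg]
      · simp
      · rintro rfl
        simp at ht
    · intro h
      simp at h
      omega

lemma TRep.mul {a : (Fin (2 * n + 1) → ℝ) → ℂ} (ha : ContDiffOn ℝ (⊤ : ℕ∞) a Ω)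
    (hF : TRep Ω T L k F) : TRep Ω T L (k + 1) (fun u x => a x * F u x) := by
  obtain ⟨c, hc, h⟩ := hF
  refine TRep.congr (F := fun u x => ∑ t' ∈ Finset.range k, ∑ K : Fin t' → Fin n,
        (a x * c (List.ofFn K) x) * appOp L (List.ofFn K) (vapp T u) x) ?_ ?_
  · refine TRep.sum _ fun t ht => TRep.sum _ fun K _ => TRep.single (ha.mul (hc _)) _ ?_
    simp at ht ⊢
    omega
  · intro u hu x hx
    simp only [h u hu x hx, Finset.mul_sum, mul_assoc]

lemma TRep.vapp (hΩ : IsOpen Ω) (hT : ContDiffOn ℝ (⊤ : ℕ∞) T Ω)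
    (hL : ∀ A, ContDiffOn ℝ (⊤ : ℕ∞) (L A) Ω) (j : Fin n)
    (hF : TRep Ω T L k F) : TRep Ω T L (k + 1) (fun u => vapp (L j) (F u)) := by
  obtain ⟨c, hc, h⟩ := hF
  refine TRep.congr (F := fun u x => ∑ t' ∈ Finset.range k, ∑ K : Fin t' → Fin n,
        (_root_.vapp (L j) (c (List.ofFn K)) x * appOp L (List.ofFn K) (_root_.vapp T u) x
          + c (List.ofFn K) x * appOp L (j :: List.ofFn K) (_root_.vapp T u) x)) ?_ ?_
  · refine TRep.sum _ fun t ht => TRep.sum _ fun K _ => TRep.add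
      (TRep.single (smooth_vapp hΩ (hL j) (hc _)) _ ?_) (TRep.single (hc _) _ ?_)
    all_goals
      simp at ht ⊢
      omega
  · intro u hu x hx
    have hd : ∀ K : List (Fin n), DifferentiableAt ℝ (c K) x := fun K => smooth_diff hΩ (hc K) hx
    have hd' : ∀ K : List (Fin n), DifferentiableAt ℝ (appOp L K (_root_.vapp T u)) x :=
      fun K => smooth_diff hΩ (smooth_appOp hΩ hL K (smooth_vapp hΩ hT hu)) hx
    rw [vapp_congr hΩ (L j) (h u hu) x hx, vapp_sum']
    · refine Finset.sum_congr rfl fun t _ => ?_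
      rw [vapp_sum']
      · refine Finset.sum_congr rfl fun K _ => ?_
        rw [vapp_mul' _ (hd _) (hd' _), appOp_cons]
      · exact fun K _ => (hd _).fun_mul (hd' _)
    · exact fun t _ => DifferentiableAt.fun_sum fun K _ => (hd _).fun_mul (hd' _)

/-- The fields whose brackets with the `L B` are smooth multiples of `T`. -/
def Good (Ω : Set (Fin (2 * n + 1) → ℝ)) (T : VF (2 * n + 1))
    (L : Fin n → VF (2 * n + 1)) (X : VF (2 * n + 1)) : Prop :=
  ContDiffOn ℝ (⊤ : ℕ∞) X Ω ∧ ∀ B, ∃ a : (Fin (2 * n + 1) → ℝ) → ℂ,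
    ContDiffOn ℝ (⊤ : ℕ∞) a Ω ∧ ∀ x ∈ Ω, vbrk X (L B) x = fun i => a x * T x i

lemma rep_main (hΩ : IsOpen Ω) (hT : Good Ω T L T)
    (hL : ∀ A, ContDiffOn ℝ (⊤ : ℕ∞) (L A) Ω) (J : List (Fin n)) :
    ∀ X, Good Ω T L X → TRep Ω T L J.length
      (fun u x => vapp X (appOp L J u) x - appOp L J (vapp X u) x) := by
  induction J with
  | nil =>
    intro X _
    exact TRep.zero.congr fun u hu x hx => sub_self _
  | cons j J ih =>
    intro X hX
    obtain ⟨a, ha, hb⟩ := hX.2 j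
    have h1 := (ih X hX).vapp hΩ hT.1 hL j
    have h2 := (ih T hT).mul ha
    have h3 := TRep.single (T := T) (L := L) (k := J.length + 1) ha J (by simp)
    refine ((h1.add h2).add h3).congr fun u hu x hx => ?_
    have hJ := smooth_appOp hΩ hL J hu
    have hXu := smooth_appOp hΩ hL J (smooth_vapp hΩ hX.1 hu)
    have hbr : vapp (vbrk X (L j)) (appOp L J u) x = a x * vapp T (appOp L J u) x := by
      simp only [vapp, hb x hx, Finset.mul_sum, mul_assoc]
    have hsub : vapp (L j) (fun y => vapp X (appOp L J u) y - appOp L J (vapp X u) y) x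
        = vapp (L j) (vapp X (appOp L J u)) x - vapp (L j) (appOp L J (vapp X u)) x := by
      rw [eq_sub_iff_add_eq, ← vapp_add']
      · simp
      · exact smooth_diff hΩ ((smooth_vapp hΩ hX.1 hJ).sub hXu) hx
      · exact smooth_diff hΩ hXu hx
    rw [appOp_cons, appOp_cons, vapp_comm hΩ hX.1 (hL j) hJ hx, hbr, hsub]
    ring

end

/-- commutation relation (3.4).  For any frame field
`X ∈ {L₁,…,L_n, L₁̄,…,L_n̄, T}` and multi-index `J ∈ {1,…,n}^t` there are smooth functions
`c_K` on `Ω`, indexed by multi-indices `K` of length `≤ t−1`, with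
`X ∘ L^J = L^J ∘ X + Σ_{|K| ≤ |J|−1} c_K·(L^K ∘ T)` on smooth functions on `Ω`. -/
theorem statement13 (n : ℕ) (hn : 1 ≤ n)
    (Ω : Set (Fin (2 * n + 1) → ℝ))
    (T : VF (2 * n + 1)) (L : Fin n → VF (2 * n + 1))
    (lv : Fin n → Fin n → (Fin (2 * n + 1) → ℝ) → ℂ)
    (hb : Fin n → (Fin (2 * n + 1) → ℝ) → ℂ)
    (hF : NFrame n Ω T L lv hb) :
    ∀ X : VF (2 * n + 1),
      (X = T ∨ (∃ A, X = L A) ∨ (∃ A, X = vconj (L A))) →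
      ∀ J : List (Fin n),
        ∃ c : List (Fin n) → (Fin (2 * n + 1) → ℝ) → ℂ,
          (∀ K : List (Fin n), ContDiffOn ℝ (⊤ : ℕ∞) (c K) Ω) ∧
          ∀ u : (Fin (2 * n + 1) → ℝ) → ℂ, ContDiffOn ℝ (⊤ : ℕ∞) u Ω →
            ∀ x ∈ Ω,
              vapp X (appOp L J u) x =
                appOp L J (vapp X u) x +
                  ∑ t' ∈ Finset.range J.length, ∑ K : Fin t' → Fin n,
                    c (List.ofFn K) x * appOp L (List.ofFn K) (vapp T u) x := by
  intro X hX J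
  have hT : Good Ω T L T := by
    refine ⟨hF.smoothT, fun B => ?_⟩
    obtain ⟨c, hc, h⟩ := hF.commLT B
    refine ⟨fun x => -c x, hc.neg, fun x hx => ?_⟩
    funext i
    have := congrFun (h x hx) i
    simp only [vbrk] at this ⊢
    rw [neg_mul, ← this]
    ring
  have hG : Good Ω T L X := by
    rcases hX with rfl | ⟨A, rfl⟩ | ⟨A, rfl⟩
    · exact hT
    · refine ⟨hF.smoothL A, fun B => ⟨fun _ => 0, contDiffOn_const, fun x hx => ?_⟩⟩
      rw [hF.commLL A B x hx]
      funext i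
      simp
    · refine ⟨?_, fun B => ⟨fun x => -(lv A B x), (hF.smooth_lv A B).neg, hF.commLbL A B⟩⟩
      refine contDiffOn_pi.2 fun i => ?_
      exact Complex.conjCLE.contDiff.comp_contDiffOn ((contDiffOn_pi.1 (hF.smoothL A)) i)
  obtain ⟨c, hc, h⟩ := rep_main hF.open_Ω hT hF.smoothL J X hG
  exact ⟨c, hc, fun u hu x hx => by rw [← h u hu x hx]; ring⟩
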